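/- (Krieger–Shallit) For every real number α > 1 there exists an infinite sequence over a finite alphabet whose critical exponent is exactly α. -/

import Mathlib

/-- `Z` is a fractional power of `X` (i.e. `Z = X…XY`, `k ≥ 1` copies of `X`
followed by a prefix `Y` of `X`). -/
def IsFracPower {α : Type*} (Z X : List α) : Prop :=
  X ≠ [] ∧ ∃ (k : ℕ) (Y : List α), 1 ≤ k ∧ Y <+: X ∧ Z = (List.replicate k X).flatten ++ Y

theorem IsFracPower.prefix_append_self {α : Type*} {Z X : List α} (h : IsFracPower Z X) :
    Z <+: X ++ Z := by
  obtain ⟨-, k, Y, -, hY, rfl⟩ := h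
  rw [← List.append_assoc, ← List.flatten_cons, ← List.replicate_succ, List.replicate_succ',
    List.flatten_concat, List.append_assoc, List.prefix_append_right_inj]
  exact hY.trans (List.prefix_append X Y)

theorem IsFracPower.length_le {α : Type*} {Z X : List α} (h : IsFracPower Z X) :
    X.length ≤ Z.length := by
  obtain ⟨-, k, Y, hk, -, rfl⟩ := h
  obtain ⟨k, rfl⟩ := Nat.exists_eq_add_of_le' hk
  simp [List.replicate_succ]

theorem isFracPower_of_prefix {α : Type*} {X : List α} (hX : X ≠ []) (Z : List α)
    (hXZ : X <+: Z) (hZ : Z <+: X ++ Z) : IsFracPower Z X := by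
  obtain ⟨W, rfl⟩ := hXZ
  rw [List.prefix_append_right_inj] at hZ
  rcases le_total X.length W.length with hl | hl
  · have hXW : X <+: W := List.prefix_of_prefix_length_le (List.prefix_append X W) hZ hl
    obtain ⟨-, k, Y, -, hY, hk⟩ := isFracPower_of_prefix hX W hXW hZ
    refine ⟨hX, k + 1, Y, by omega, hY, ?_⟩
    rw [List.replicate_succ, List.flatten_cons, List.append_assoc, ← hk]
  · exact ⟨hX, 1, W, le_rfl,
      List.prefix_of_prefix_length_le hZ (List.prefix_append X W) hl, by simp⟩
termination_by Z.length
decreasing_by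
  subst_vars
  simpa [List.length_pos_iff] using hX

theorem IsFracPower.apply_eq {A : Type*} {ω : ℕ → A} {a n : ℕ} {X : List A}
    (h : IsFracPower ((List.range n).map fun i => ω (a + i)) X) {t : ℕ} (ht : t + X.length < n) :
    ω (a + t) = ω (a + t + X.length) := by
  have := List.prefix_iff_getElem?.1 h.prefix_append_self (t + X.length) (by simpa using ht)
  rw [List.getElem?_append_right (by omega)] at this
  have ht' : t < n := by omega
  simpa [ht', add_assoc] using this

theorem isFracPower_of_apply_eq {A : Type*} {ω : ℕ → A} {a n q : ℕ} (hq : 0 < q) (hqn : q ≤ n)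
    (h : ∀ t, t + q < n → ω (a + t) = ω (a + t + q)) :
    IsFracPower ((List.range n).map fun i => ω (a + i))
      ((List.range q).map fun i => ω (a + i)) := by
  refine isFracPower_of_prefix (by simpa using hq.ne') _ ?_ ?_
  · rw [List.prefix_iff_getElem?]
    intro i hi
    have hi' : i < n := by simp at hi; omega
    simp [hi']
  · rw [List.prefix_iff_getElem?]
    intro i hi
    have hi' : i < n := by simpa using hi
    rcases lt_or_ge i q with hiq | hiq
    · rw [List.getElem?_append_left (by simpa using hiq)]
      simp [hiq]
    · obtain ⟨t, rfl⟩ := Nat.exists_eq_add_of_le' hiq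
      rw [List.getElem?_append_right (by simp)]
      simp [show t < n by omega, h t hi', add_assoc]

/-- The letter at position `n` of the periodic word of period `b ^ k`: the residue of `n` mod `b`,
and the two lowest digits in base `b` of the part of `n % b ^ k` prime to `b`. -/
def toeplitzLetter (b k n : ℕ) : ZMod b × ZMod (b ^ 2) :=
  (n, (n % b ^ k).divMaxPow b)

theorem toeplitzLetter_add {b k n q : ℕ} (hq : b ^ k ∣ q) (hk : 1 ≤ k) :
    toeplitzLetter b k (n + q) = toeplitzLetter b k n := by
  obtain ⟨c, rfl⟩ := hq
  obtain ⟨k, rfl⟩ := Nat.exists_eq_add_of_le' hk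
  simp [toeplitzLetter, pow_succ]

theorem toeplitzLetter_pow_mul_snd {b k i m : ℕ} (hb : 2 ≤ b) (hik : i + 2 ≤ k) (hm : ¬ b ∣ m) :
    (toeplitzLetter b k (b ^ i * m)).2 = m := by
  obtain ⟨l, rfl⟩ := Nat.exists_eq_add_of_le hik
  have hsplit : b ^ i * m % b ^ (i + 2 + l) = b ^ i * (m % b ^ (2 + l)) := by
    rw [add_assoc, pow_add b i, Nat.mul_mod_mul_left]
  have hm' : ¬ b ∣ m % b ^ (2 + l) := by
    rwa [Nat.dvd_mod_iff (dvd_pow_self b (by omega))]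
  have hdiv : (m % b ^ (2 + l)).divMaxPow b = m % b ^ (2 + l) := by
    simpa [padicValNat.eq_zero_of_not_dvd hm'] using
      Nat.pow_padicValNat_mul_divMaxPow b (m % b ^ (2 + l))
  simp only [toeplitzLetter]
  rw [hsplit, Nat.divMaxPow_base_pow_mul (by omega), hdiv, ZMod.natCast_eq_natCast_iff',
    Nat.mod_mod_of_dvd _ (pow_dvd_pow b (by omega))]

theorem exists_pow_mul_not_dvd_mem_window {b i s L : ℕ} (hb : 2 ≤ b) (hL : 3 * b ^ i ≤ L) :
    ∃ m, ¬ b ∣ m ∧ s ≤ b ^ i * m ∧ b ^ i * m < s + L := by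
  have hpos : 0 < b ^ i := by positivity
  have h1 := Nat.div_add_mod s (b ^ i)
  have h2 := Nat.mod_lt s hpos
  generalize s / b ^ i = c at h1
  generalize s % b ^ i = r at h1 h2
  by_cases hc : b ∣ c + 1
  · refine ⟨c + 2, fun h => ?_, by linarith [mul_add (b ^ i) c 2],
      by linarith [mul_add (b ^ i) c 2]⟩
    have := (Nat.dvd_add_right hc).1 (show b ∣ (c + 1) + 1 from h)
    have := Nat.le_of_dvd one_pos this
    omega
  · exact ⟨c + 1, hc, by linarith [mul_add (b ^ i) c 1], by linarith [mul_add (b ^ i) c 1]⟩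

/-- A factor of the periodic word that repeats at a distance not divisible by the period is short
compared to that distance. -/
theorem mul_le_of_toeplitzLetter_eq {b k s q L : ℕ} (hb : 2 ≤ b)
    (hqk : ¬ b ^ k ∣ q)
    (h : ∀ t < L, toeplitzLetter b k (s + t) = toeplitzLetter b k (s + t + q)) :
    b * L ≤ 3 * q := by
  have hq : q ≠ 0 := by rintro rfl; simp at hqk
  rcases Nat.eq_zero_or_pos L with rfl | hL
  · simp
  have hbq : b ∣ q := by
    have := congrArg Prod.fst (h 0 hL)
    simp only [toeplitzLetter, Nat.cast_add, left_eq_add] at this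
    exact (ZMod.natCast_eq_zero_iff q b).1 this
  obtain ⟨j, r, hr, rfl⟩ := Nat.exists_eq_pow_mul_and_not_dvd hq b (by omega)
  have hjk : j < k := by
    by_contra! hkj
    exact hqk ((pow_dvd_pow b hkj).mul_right r)
  rcases j with - | i
  · simp_all
  by_contra! hlt
  have hr0 : 0 < r := Nat.pos_of_ne_zero (by rintro rfl; simp at hr)
  have hwin : 3 * b ^ i ≤ L := by
    have : b * (3 * b ^ i) ≤ b * L := by
      calc b * (3 * b ^ i) = 3 * (b ^ (i + 1) * 1) := by ring
        _ ≤ 3 * (b ^ (i + 1) * r) := by gcongr; omega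
        _ ≤ b * L := hlt.le
    exact Nat.le_of_mul_le_mul_left this (by omega)
  obtain ⟨m, hm, hsm, hmL⟩ := exists_pow_mul_not_dvd_mem_window (s := s) hb hwin
  have hmq : b ^ i * m + b ^ (i + 1) * r = b ^ i * (m + b * r) := by ring
  have hm' : ¬ b ∣ m + b * r := by rwa [Nat.dvd_add_left (dvd_mul_right b r)]
  have := congrArg Prod.snd (h (b ^ i * m - s) (by omega))
  rw [Nat.add_sub_cancel' hsm, hmq, toeplitzLetter_pow_mul_snd hb (by omega) hm,
    toeplitzLetter_pow_mul_snd hb (by omega) hm', Nat.cast_add, left_eq_add,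
    ZMod.natCast_eq_zero_iff, pow_two] at this
  exact hr (Nat.dvd_of_mul_dvd_mul_left (by omega) this)

theorem exists_mem_Ico_of_strictMono {T : ℕ → ℕ} (hT : StrictMono T) (h0 : T 0 = 0) (n : ℕ) :
    ∃ i, T i ≤ n ∧ n < T (i + 1) := by
  induction n with
  | zero => exact ⟨0, h0.le, by simpa [h0] using hT one_pos⟩
  | succ n ih =>
    obtain ⟨i, hi, hi'⟩ := ih
    rcases Nat.lt_or_ge (n + 1) (T (i + 1)) with h | h
    · exact ⟨i, by omega, h⟩
    · exact ⟨i + 1, h, by have := hT (show i + 1 < i + 1 + 1 by omega); omega⟩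

/-- The first position of the block `i`; the block `i` has length `⌊α * b ^ (i + 1)⌋`. -/
noncomputable def blockStart (α : ℝ) (b i : ℕ) : ℕ :=
  ∑ j ∈ Finset.range i, ⌊α * b ^ (j + 1)⌋₊

section Blocks

variable {α : ℝ} {b : ℕ}

theorem pow_le_floor (hα : 1 < α) (i : ℕ) : b ^ i ≤ ⌊α * b ^ i⌋₊ := by
  refine Nat.le_floor ?_
  push_cast
  exact le_mul_of_one_le_left (by positivity) hα.le

theorem blockStart_succ (i : ℕ) :
    blockStart α b (i + 1) = blockStart α b i + ⌊α * b ^ (i + 1)⌋₊ :=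
  Finset.sum_range_succ _ _

theorem blockStart_strictMono (hα : 1 < α) (hb : 0 < b) : StrictMono (blockStart α b) := by
  refine strictMono_nat_of_lt_succ fun i => ?_
  have h1 := pow_le_floor (b := b) hα (i + 1)
  have h2 : 0 < b ^ (i + 1) := by positivity
  rw [blockStart_succ]
  omega

theorem blockStart_mul_le (hα : 1 < α) (hb : 1 ≤ b) (i : ℕ) :
    (blockStart α b i : ℝ) * (b - 1) ≤ α * b ^ (i + 1) := by
  have hb' : (1 : ℝ) ≤ b := by exact_mod_cast hb
  induction i with
  | zero => simp [blockStart]; positivity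
  | succ i ih =>
    have hf : (⌊α * b ^ (i + 1)⌋₊ : ℝ) ≤ α * b ^ (i + 1) := Nat.floor_le (by positivity)
    rw [blockStart_succ, Nat.cast_add, pow_succ _ (i + 1)]
    nlinarith [mul_le_mul_of_nonneg_right hf (sub_nonneg.2 hb')]

theorem blockStart_succ_le (hα : 1 < α) (hb : 2 ≤ b) (hαb : α ≤ (α - 1) * (b - 1)) (i : ℕ) :
    (blockStart α b (i + 1) : ℝ) ≤ (α - 1) * b ^ (i + 2) := by
  have hb' : (2 : ℝ) ≤ b := by exact_mod_cast hb
  have h := blockStart_mul_le hα (by omega : 1 ≤ b) (i + 1)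
  have hp : (0 : ℝ) ≤ b ^ (i + 2) := by positivity
  refine le_of_mul_le_mul_right (h.trans ?_) (by linarith : (0 : ℝ) < b - 1)
  nlinarith [mul_le_mul_of_nonneg_right hαb hp]

variable {idx : ℕ → ℕ}

theorem idx_eq_of_mem_block (hα : 1 < α) (hb : 0 < b)
    (hidx : ∀ n, blockStart α b (idx n) ≤ n ∧ n < blockStart α b (idx n + 1)) {i n : ℕ}
    (h1 : blockStart α b i ≤ n) (h2 : n < blockStart α b (i + 1)) : idx n = i := by
  have hT := blockStart_strictMono hα hb
  have h3 := hT.lt_iff_lt.1 ((hidx n).1.trans_lt h2)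
  have h4 := hT.lt_iff_lt.1 (h1.trans_lt (hidx n).2)
  omega

/-- Letters of the word obtained by concatenating, for each `i`, a factor of length
`⌊α * b ^ (i + 1)⌋` of the periodic word of period `b ^ (i + 1)`, tagged by the parity of `i`. -/
def blockLetter (b : ℕ) (idx : ℕ → ℕ) (n : ℕ) : ZMod 2 × ZMod b × ZMod (b ^ 2) :=
  (idx n, toeplitzLetter b (idx n + 1) n)

theorem length_le_of_blockLetter_eq (hα : 1 < α) (hb : 2 ≤ b) (hαb : α ≤ (α - 1) * (b - 1))
    (hb3 : 3 ≤ (α - 1) * b)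
    (hidx : ∀ n, blockStart α b (idx n) ≤ n ∧ n < blockStart α b (idx n + 1))
    {s q L : ℕ} (hq : 0 < q)
    (h : ∀ t < L, blockLetter b idx (s + t) = blockLetter b idx (s + t + q)) :
    (L : ℝ) ≤ (α - 1) * q := by
  have hT := blockStart_strictMono (α := α) (b := b) hα (by omega)
  have hα0 : 0 ≤ α - 1 := by linarith
  rcases Nat.eq_zero_or_pos L with rfl | hL
  · simp only [Nat.cast_zero]; positivity
  have hpar : ∀ t < L, idx (s + t) % 2 = idx (s + t + q) % 2 := fun t ht =>
    (ZMod.natCast_eq_natCast_iff' _ _ _).1 (congrArg Prod.fst (h t ht))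
  obtain ⟨e, rfl⟩ := Nat.exists_eq_add_of_lt hL
  simp only [zero_add] at *
  obtain ⟨hie, hie'⟩ := hidx (s + e)
  obtain ⟨hje, hje'⟩ := hidx (s + e + q)
  obtain ⟨i, hi⟩ : ∃ i, idx (s + e) = i := ⟨_, rfl⟩
  rw [hi] at hie hie'
  have hij : i ≤ idx (s + e + q) := by
    have := hT.lt_iff_lt.1 (hie.trans_lt ((Nat.le_add_right _ q).trans_lt hje'))
    omega
  rcases hij.eq_or_lt with hij | hij
  · -- both windows end in the block `i`, and parity forces them to start in it
    rw [← hij] at hje hje'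
    have hs : blockStart α b i ≤ s := by
      by_contra! hs
      have hpos : 0 < i := by
        rcases Nat.eq_zero_or_pos i with h0 | h0
        · simp [h0, blockStart] at hs
        · exact h0
      obtain ⟨l, rfl⟩ : ∃ l, i = l + 1 := ⟨i - 1, by omega⟩
      have hll := hT (show l < l + 1 by omega)
      have h1 : idx (blockStart α b (l + 1) - 1) = l := by
        refine idx_eq_of_mem_block hα (by omega) hidx ?_ ?_ <;> omega
      have h2 : idx (blockStart α b (l + 1) - 1 + q) = l + 1 := by
        refine idx_eq_of_mem_block hα (by omega) hidx ?_ ?_ <;> omega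
      have := hpar (blockStart α b (l + 1) - 1 - s) (by omega)
      rw [show s + (blockStart α b (l + 1) - 1 - s) = blockStart α b (l + 1) - 1 by omega, h1, h2] at this
      omega
    have hword : ∀ t < e + 1,
        toeplitzLetter b (i + 1) (s + t) = toeplitzLetter b (i + 1) (s + t + q) := by
      intro t ht
      have h1 : idx (s + t) = i :=
        idx_eq_of_mem_block hα (by omega) hidx (by omega) (by omega)
      have h2 : idx (s + t + q) = i :=
        idx_eq_of_mem_block hα (by omega) hidx (by omega) (by omega)
      have := congrArg Prod.snd (h t ht)
      simpa only [blockLetter, h1, h2] using this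
    by_cases hdvd : b ^ (i + 1) ∣ q
    · have hle : (b : ℝ) ^ (i + 1) ≤ q := by exact_mod_cast Nat.le_of_dvd hq hdvd
      have hlen : e + 1 + q ≤ ⌊α * b ^ (i + 1)⌋₊ := by
        rw [blockStart_succ] at hje'
        omega
      have hlen' : ((e + 1 + q : ℕ) : ℝ) ≤ α * b ^ (i + 1) :=
        (Nat.le_floor_iff (by positivity)).1 hlen
      push_cast at hlen' ⊢
      nlinarith
    · have hle : (b : ℝ) * (e + 1 : ℕ) ≤ 3 * q := by
        exact_mod_cast mul_le_of_toeplitzLetter_eq hb hdvd hword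
      have hb0 : (0 : ℝ) < b := by positivity
      refine le_of_mul_le_mul_left (hle.trans ?_) hb0
      nlinarith [mul_le_mul_of_nonneg_right hb3 (Nat.cast_nonneg (α := ℝ) q)]
  · -- by parity, the shift jumps over the whole block `i + 1`
    have hij2 : i + 2 ≤ idx (s + e + q) := by
      have := hpar e (by omega)
      rw [hi] at this
      omega
    have h1 : blockStart α b (i + 2) ≤ s + e + q := (hT.monotone hij2).trans hje
    have hsucc := blockStart_succ (α := α) (b := b) (i + 1)
    rw [show i + 1 + 1 = i + 2 from rfl] at hsucc
    have h2 := pow_le_floor (b := b) hα (i + 2)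
    have h3 : (b : ℝ) ^ (i + 2) ≤ q := by
      exact_mod_cast (show b ^ (i + 2) ≤ q by omega)
    have h4 : ((e + 1 : ℕ) : ℝ) ≤ blockStart α b (i + 1) := by
      exact_mod_cast (show e + 1 ≤ blockStart α b (i + 1) by omega)
    calc ((e + 1 : ℕ) : ℝ) ≤ (α - 1) * b ^ (i + 2) := h4.trans (blockStart_succ_le hα hb hαb i)
      _ ≤ (α - 1) * q := by gcongr

theorem blockLetter_eq_add_pow (hα : 1 < α) (hb : 0 < b)
    (hidx : ∀ n, blockStart α b (idx n) ≤ n ∧ n < blockStart α b (idx n + 1)) {i t : ℕ}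
    (ht : t + b ^ (i + 1) < ⌊α * b ^ (i + 1)⌋₊) :
    blockLetter b idx (blockStart α b i + t) =
      blockLetter b idx (blockStart α b i + t + b ^ (i + 1)) := by
  have h1 : idx (blockStart α b i + t) = i :=
    idx_eq_of_mem_block hα hb hidx (by omega) (by rw [blockStart_succ]; omega)
  have h2 : idx (blockStart α b i + t + b ^ (i + 1)) = i :=
    idx_eq_of_mem_block hα hb hidx (by omega) (by rw [blockStart_succ]; omega)
  simp only [blockLetter, h1, h2, toeplitzLetter_add dvd_rfl (Nat.le_add_left 1 i)]

end Blocks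

theorem exists_word_with_exponents {α : ℝ} (hα : 1 < α) :
    ∃ (A : Type) (_ : Finite A) (_ : Nonempty A) (ω : ℕ → A) (b : ℕ), 2 ≤ b ∧
      (∀ s q L : ℕ, 0 < q → (∀ t < L, ω (s + t) = ω (s + t + q)) → (L : ℝ) ≤ (α - 1) * q) ∧
      ∀ i : ℕ, ∃ a, ∀ t, t + b ^ (i + 1) < ⌊α * b ^ (i + 1)⌋₊ →
        ω (a + t) = ω (a + t + b ^ (i + 1)) := by
  have hα0 : 0 < α - 1 := by linarith
  obtain ⟨b, hbig⟩ := exists_nat_ge (2 + (α + 3) / (α - 1))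
  have hdiv : 0 < (α + 3) / (α - 1) := by positivity
  have hb : 2 ≤ b := by
    have : (2 : ℝ) ≤ b := by linarith
    exact_mod_cast this
  have hmul : α + 3 ≤ (α - 1) * (b - 2) := by
    rw [mul_comm, ← div_le_iff₀ hα0]
    linarith
  have : NeZero b := ⟨by omega⟩
  have hT := blockStart_strictMono (α := α) (b := b) hα (by omega)
  choose idx hidx using exists_mem_Ico_of_strictMono hT (by simp [blockStart])
  refine ⟨ZMod 2 × ZMod b × ZMod (b ^ 2), inferInstance, inferInstance, blockLetter b idx, b, hb,
    fun s q L hq h => ?_, fun i => ⟨blockStart α b i, fun t ht => ?_⟩⟩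
  · exact length_le_of_blockLetter_eq hα hb (by nlinarith) (by nlinarith) hidx hq h
  · exact blockLetter_eq_add_pow hα (by omega) hidx ht

/-- Krieger–Shallit: every real `α > 1` is the critical exponent (the least upper
bound of exponents of fractional powers occurring as substrings) of some sequence
over a finite alphabet. -/
theorem krieger_shallit (α : ℝ) (hα : 1 < α) :
    ∃ (m : ℕ) (ω : ℕ → Fin (m + 1)),
      IsLUB {e : ℝ | ∃ (a n : ℕ) (X : List (Fin (m + 1))),
        IsFracPower ((List.range n).map (fun i => ω (a + i))) X ∧
        e = (n : ℝ) / X.length} α := by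
  obtain ⟨A, _, _, ω, b, hb, hupper, hlower⟩ := exists_word_with_exponents hα
  obtain ⟨N, ⟨f⟩⟩ := Finite.exists_equiv_fin A
  obtain ⟨m, rfl⟩ : ∃ m, N = m + 1 :=
    Nat.exists_eq_succ_of_ne_zero (by rintro rfl; exact (f (Classical.arbitrary A)).elim0)
  refine ⟨m, fun n => f (ω n), ?_, fun B hB => ?_⟩
  · rintro _ ⟨a, n, X, hX, rfl⟩
    have hq : 0 < X.length := List.length_pos_iff.2 hX.1
    have hqn : X.length ≤ n := by simpa using hX.length_le
    have := hupper a X.length (n - X.length) hq fun t ht =>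
      f.injective (hX.apply_eq (ω := fun n => f (ω n)) (by omega))
    rw [Nat.cast_sub hqn] at this
    rw [div_le_iff₀ (by exact_mod_cast hq)]
    linarith
  · refine le_of_forall_pos_lt_add fun ε hε => ?_
    have hb1 : (1 : ℝ) < b := by exact_mod_cast hb
    obtain ⟨i, hi⟩ := pow_unbounded_of_one_lt ε⁻¹ hb1
    have hi' : ε⁻¹ < (b : ℝ) ^ (i + 1) :=
      hi.trans_le (pow_le_pow_right₀ hb1.le (Nat.le_succ i))
    have hp : (0 : ℝ) < (b : ℝ) ^ (i + 1) := by positivity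
    obtain ⟨a, ha⟩ := hlower i
    have hle : (⌊α * b ^ (i + 1)⌋₊ : ℝ) / b ^ (i + 1) ≤ B :=
      hB ⟨a, _, _, isFracPower_of_apply_eq (ω := fun n => f (ω n)) (q := b ^ (i + 1)) (by positivity)
        (pow_le_floor hα _) (fun t ht => congrArg f (ha t ht)), by simp⟩
    rw [div_le_iff₀ hp] at hle
    have hfl := Nat.lt_floor_add_one (α * b ^ (i + 1))
    have hε1 : 1 < ε * b ^ (i + 1) := by rwa [inv_lt_iff_one_lt_mul₀' hε] at hi'
    refine lt_of_mul_lt_mul_right ?_ hp.le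
    linarith
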